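/- arXiv:2403.11213 — 12 statements merged into one kernel-verified Lean document; each statement's English description precedes it below -/
import Mathlib

section
/- Let p ∈ 𝒫 be strictly positive, assume the balance condition ∑_{α∈D} w(α) α_i^+ = ∑_{α∈D} w(α) α_i^− for every layer i, set p_* := min_i p_i, and define the norm ‖f‖ := (max_{i} |f(i)|) + (1/√p_*)·√(Var_{π_p}(f)) for f : {1,…,I} → ℝ. Then for every f with ∑_{i=1}^I π_p(i) f(i) = 0, the layer chain satisfies ‖L_p f‖ ≤ (1 − 1/(4Δ)) · ‖f‖, where (L_p f)(i) = ∑_{j=1}^I L_p(i,j) f(j). -/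
open Finset in
/-- Cauchy–Schwarz for a nonnegative weight. -/
theorem sq_sum_mul_le_sum_mul_sum_mul_sq {ι : Type*} [Fintype ι] (a x : ι → ℝ)
    (ha : ∀ i, 0 ≤ a i) : (∑ i, a i * x i) ^ 2 ≤ (∑ i, a i) * ∑ i, a i * x i ^ 2 :=
  sum_sq_le_sum_mul_sum_of_sq_le_mul univ (fun i _ => ha i)
    (fun i _ => mul_nonneg (ha i) (sq_nonneg _)) (fun i _ => le_of_eq (by ring))

theorem abs_sum_mul_le_sum_mul {ι : Type*} [Fintype ι] (a x : ι → ℝ) (M : ℝ)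
    (ha : ∀ i, 0 ≤ a i) (hx : ∀ i, |x i| ≤ M) : |∑ i, a i * x i| ≤ (∑ i, a i) * M := by
  rw [Finset.sum_mul]
  refine (Finset.abs_sum_le_sum_abs _ _).trans (Finset.sum_le_sum fun i _ => ?_)
  rw [abs_mul, abs_of_nonneg (ha i)]
  exact mul_le_mul_of_nonneg_left (hx i) (ha i)

section Minorization

variable {ι : Type*} [Fintype ι] {a π f : ι → ℝ} {ε : ℝ}

theorem sum_sub_mul_eq_of_mean_zero (hf : ∑ i, π i * f i = 0) :
    ∑ i, (a i - ε * π i) * f i = ∑ i, a i * f i := by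
  simp only [sub_mul, mul_assoc, Finset.sum_sub_distrib, ← Finset.mul_sum, hf, mul_zero, sub_zero]

theorem sum_sub_mul_eq_one_sub (ha : ∑ i, a i = 1) (hπ : ∑ i, π i = 1) :
    ∑ i, (a i - ε * π i) = 1 - ε := by
  rw [Finset.sum_sub_distrib, ← Finset.mul_sum, ha, hπ, mul_one]

/-- A probability vector dominating `ε π` contracts the sup norm of `π`-centred functions. -/
theorem abs_sum_mul_le_of_minorized (ha : ∑ i, a i = 1) (hπ : ∑ i, π i = 1)
    (hle : ∀ i, ε * π i ≤ a i) (hf : ∑ i, π i * f i = 0) {M : ℝ} (hM : ∀ i, |f i| ≤ M) :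
    |∑ i, a i * f i| ≤ (1 - ε) * M := by
  rw [← sum_sub_mul_eq_of_mean_zero (ε := ε) hf, ← sum_sub_mul_eq_one_sub ha hπ]
  exact abs_sum_mul_le_sum_mul _ _ _ (fun i => sub_nonneg.2 (hle i)) hM

theorem sq_sum_mul_le_of_minorized (ha : ∑ i, a i = 1) (hπ : ∑ i, π i = 1)
    (hle : ∀ i, ε * π i ≤ a i) (hf : ∑ i, π i * f i = 0) :
    (∑ i, a i * f i) ^ 2 ≤ (1 - ε) * (∑ i, a i * f i ^ 2 - ε * ∑ i, π i * f i ^ 2) := by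
  have h := sq_sum_mul_le_sum_mul_sum_mul_sq (fun i => a i - ε * π i) f
    (fun i => sub_nonneg.2 (hle i))
  rw [sum_sub_mul_eq_of_mean_zero hf, sum_sub_mul_eq_one_sub ha hπ] at h
  simpa only [sub_mul _ _ (_ ^ 2), mul_assoc, Finset.sum_sub_distrib, ← Finset.mul_sum] using h

end Minorization

/-- Corollary 3.1 of the paper.
Multiplex configuration model setup: `I ≥ 2` layers, maximum degree `Δ ≥ 2`, nonempty
finite type set `D` with out/in-degrees in `{1,…,Δ}`, strictly positive probability
weights `w`.  Let `p` be a strictly positive doubly stochastic edge-probability vector,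
assume the balance condition `∑_α w α · dout α i = ∑_α w α · din α i` for every layer
`i`, let `pstar := min_i p i`, `π` the stationary layer distribution, `L` the layer
chain, and define the norm `Nrm f := (max_i |f i|) + (1/√pstar)·√(Var_π f)`.
Then every `f` with `π`-mean zero satisfies `Nrm (L f) ≤ (1 − 1/(4Δ)) · Nrm f`. -/
theorem layer_chain_norm_contraction
    (I Δ : ℕ) (hI : 2 ≤ I) (hΔ : 2 ≤ Δ)
    (D : Type) [Fintype D] [Nonempty D]
    (dout din : D → Fin I → ℕ)
    (hdout : ∀ α i, 1 ≤ dout α i ∧ dout α i ≤ Δ)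
    (hdin : ∀ α i, 1 ≤ din α i ∧ din α i ≤ Δ)
    (w : D → ℝ) (hw : ∀ α, 0 < w α) (hw1 : ∑ α, w α = 1)
    (p : Fin I → ℝ) (hp01 : ∀ i, 0 < p i ∧ p i ≤ 1)
    (hpc : ∀ α : D, (∑ i, p i * (dout α i : ℝ)) = 1 ∧ (∑ i, p i * (din α i : ℝ)) = 1)
    (hbal : ∀ i, (∑ α, w α * (dout α i : ℝ)) = ∑ α, w α * (din α i : ℝ))
    (pstar : ℝ) (hpstar : pstar = ⨅ i, p i)
    (π : Fin I → ℝ) (hπ : ∀ i, π i = ∑ α, w α * (dout α i : ℝ) * p i)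
    (L : Fin I → Fin I → ℝ)
    (hL : ∀ i j, L i j =
      (∑ α, w α * (din α i : ℝ) * (dout α j : ℝ) * p j) / (∑ α, w α * (din α i : ℝ)))
    (Nrm : (Fin I → ℝ) → ℝ)
    (hNrm : ∀ f, Nrm f = (⨆ i, |f i|) +
      (1 / Real.sqrt pstar) * Real.sqrt (∑ i, π i * f i ^ 2 - (∑ i, π i * f i) ^ 2)) :
    ∀ f : Fin I → ℝ, (∑ i, π i * f i) = 0 →
      Nrm (fun i => ∑ j, L i j * f j) ≤ (1 - 1 / (4 * Δ)) * Nrm f := by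
  intro f hf
  have : Nonempty (Fin I) := ⟨⟨0, by lia⟩⟩
  have hΔ0 : (0 : ℝ) < Δ := by exact_mod_cast (by lia : 0 < Δ)
  have hΔ1 : (1 : ℝ) ≤ Δ := by exact_mod_cast (by lia : 1 ≤ Δ)
  have hε0 : 0 ≤ 1 - 1 / (Δ : ℝ) := sub_nonneg.2 ((div_le_one hΔ0).2 hΔ1)
  set b : Fin I → ℝ := fun i => ∑ α, w α * (din α i : ℝ) with hb
  have hb0 : ∀ i, 0 < b i := fun i => Finset.sum_pos
    (fun α _ => mul_pos (hw α) (by exact_mod_cast (hdin α i).1)) Finset.univ_nonempty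
  have hbΔ : ∀ i, b i ≤ Δ := fun i => by
    calc b i ≤ ∑ α, w α * (Δ : ℝ) := Finset.sum_le_sum fun α _ =>
          mul_le_mul_of_nonneg_left (by exact_mod_cast (hdin α i).2) (hw α).le
      _ = Δ := by rw [← Finset.sum_mul, hw1, one_mul]
  have hπb : ∀ i, π i = b i * p i := fun i => by rw [hπ, ← Finset.sum_mul, hbal]
  have hπ0 : ∀ i, 0 ≤ π i := fun i => hπb i ▸ mul_nonneg (hb0 i).le (hp01 i).1.le
  -- `κ α` is the law of the layer chosen by a vertex of type `α`,
  -- `ν i` the law of the type reached through layer `i`.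
  set κ : D → Fin I → ℝ := fun α j => p j * (dout α j : ℝ) with hκ
  set ν : Fin I → D → ℝ := fun i α => w α * (din α i : ℝ) / b i with hν
  have hκ1 : ∀ α, ∑ j, κ α j = 1 := fun α => (hpc α).1
  have hκπ : ∀ α j, 1 / (Δ : ℝ) * π j ≤ κ α j := fun α j => by
    have h1 : (1 : ℝ) ≤ dout α j := by exact_mod_cast (hdout α j).1
    calc 1 / (Δ : ℝ) * π j = b j / Δ * p j := by rw [hπb]; ring
      _ ≤ 1 * p j := mul_le_mul_of_nonneg_right ((div_le_one hΔ0).2 (hbΔ j)) (hp01 j).1.le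
      _ ≤ κ α j := by rw [one_mul]; exact le_mul_of_one_le_right (hp01 j).1.le h1
  have hν0 : ∀ i α, 0 ≤ ν i α := fun i α =>
    div_nonneg (mul_nonneg (hw α).le (Nat.cast_nonneg _)) (hb0 i).le
  have hν1 : ∀ i, ∑ α, ν i α = 1 := fun i => by
    rw [← Finset.sum_div]; exact div_self (hb0 i).ne'
  have hwκ : ∀ h : Fin I → ℝ, ∑ α, w α * ∑ j, κ α j * h j = ∑ j, π j * h j := fun h => by
    simp only [Finset.mul_sum]
    rw [Finset.sum_comm]
    refine Finset.sum_congr rfl fun j _ => ?_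
    rw [hπ, Finset.sum_mul]
    exact Finset.sum_congr rfl fun α _ => by simp only [hκ]; ring
  have hπν : ∀ h : D → ℝ, ∑ i, π i * ∑ α, ν i α * h α = ∑ α, w α * h α := fun h => by
    simp only [Finset.mul_sum]
    rw [Finset.sum_comm]
    refine Finset.sum_congr rfl fun α _ => ?_
    rw [← mul_one (w α), ← (hpc α).2, Finset.mul_sum, Finset.sum_mul]
    refine Finset.sum_congr rfl fun i _ => ?_
    have := (hb0 i).ne'
    simp only [hν, hπb]
    field_simp
  have hπ1 : ∑ j, π j = 1 := by simpa [hκ1, hw1] using (hwκ fun _ => 1).symm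
  set g : D → ℝ := fun α => ∑ j, κ α j * f j with hg
  have hLf : ∀ i, ∑ j, L i j * f j = ∑ α, ν i α * g α := fun i => by
    simp only [hg, Finset.mul_sum]
    rw [Finset.sum_comm]
    refine Finset.sum_congr rfl fun j _ => ?_
    rw [hL, Finset.sum_div, Finset.sum_mul]
    exact Finset.sum_congr rfl fun α _ => by simp only [hν, hκ, hb]; ring
  have hsup : (⨆ i, |∑ j, L i j * f j|) ≤ (1 - 1 / (Δ : ℝ)) * ⨆ i, |f i| := by
    refine ciSup_le fun i => ?_
    have h := abs_sum_mul_le_sum_mul (ν i) g _ (hν0 i) fun α =>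
      abs_sum_mul_le_of_minorized (hκ1 α) hπ1 (hκπ α) hf
        fun j => le_ciSup (f := fun j => |f j|) (Set.finite_range _).bddAbove j
    rwa [hν1, one_mul, ← hLf] at h
  have hsq : ∑ i, π i * (∑ j, L i j * f j) ^ 2 ≤
      (1 - 1 / (Δ : ℝ)) ^ 2 * ∑ i, π i * f i ^ 2 := by
    calc ∑ i, π i * (∑ j, L i j * f j) ^ 2 ≤ ∑ i, π i * ∑ α, ν i α * g α ^ 2 := by
          refine Finset.sum_le_sum fun i _ => mul_le_mul_of_nonneg_left ?_ (hπ0 i)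
          simpa only [hLf, hν1, one_mul] using sq_sum_mul_le_sum_mul_sum_mul_sq _ g (hν0 i)
      _ = ∑ α, w α * g α ^ 2 := hπν _
      _ ≤ ∑ α, w α * ((1 - 1 / (Δ : ℝ)) *
            (∑ j, κ α j * f j ^ 2 - 1 / (Δ : ℝ) * ∑ j, π j * f j ^ 2)) :=
          Finset.sum_le_sum fun α _ => mul_le_mul_of_nonneg_left
            (sq_sum_mul_le_of_minorized (hκ1 α) hπ1 (hκπ α) hf) (hw α).le
      _ = (1 - 1 / (Δ : ℝ)) * (∑ α, w α * ∑ j, κ α j * f j ^ 2 -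
            (∑ α, w α) * (1 / (Δ : ℝ) * ∑ j, π j * f j ^ 2)) := by
          rw [Finset.sum_mul Finset.univ w, ← Finset.sum_sub_distrib,
            Finset.mul_sum Finset.univ _ (1 - 1 / (Δ : ℝ))]
          exact Finset.sum_congr rfl fun α _ => by ring
      _ = (1 - 1 / (Δ : ℝ)) ^ 2 * ∑ i, π i * f i ^ 2 := by rw [hwκ, hw1]; ring
  have hsqrt : √(∑ i, π i * (∑ j, L i j * f j) ^ 2 - (∑ i, π i * ∑ j, L i j * f j) ^ 2) ≤
      (1 - 1 / (Δ : ℝ)) * √(∑ i, π i * f i ^ 2 - (∑ i, π i * f i) ^ 2) := by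
    rw [hf, zero_pow two_ne_zero, sub_zero]
    refine Real.sqrt_le_iff.2 ⟨by positivity, ?_⟩
    rw [mul_pow, Real.sq_sqrt (Finset.sum_nonneg fun i _ => mul_nonneg (hπ0 i) (sq_nonneg _))]
    exact (sub_le_self _ (sq_nonneg _)).trans hsq
  have hN0 : 0 ≤ Nrm f := by
    rw [hNrm]
    exact add_nonneg (Real.iSup_nonneg fun _ => abs_nonneg _) (by positivity)
  calc Nrm (fun i => ∑ j, L i j * f j) ≤ (1 - 1 / (Δ : ℝ)) * Nrm f := by
        rw [hNrm, hNrm f, mul_add, mul_left_comm]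
        gcongr
    _ ≤ (1 - 1 / (4 * Δ)) * Nrm f := by
        gcongr
        linarith
end

section
/- Let L be a row-stochastic matrix on a nonempty finite state space S, let π be a strictly positive probability vector on S with πL = π, and let Δ ≥ 1 be a real number such that L(i,j) ≥ π(j)/Δ for all i, j ∈ S. Then for every f : S → ℝ, Var_π(Lf) ≤ (1 − 1/Δ) · Var_π(f), where (Lf)(i) = ∑_j L(i,j) f(j). -/
theorem sum_mul_sq_sub_sq_sum_mul {S : Type*} [Fintype S] (p h : S → ℝ) (hp : ∑ i, p i = 1) :
    ∑ i, p i * h i ^ 2 - (∑ i, p i * h i) ^ 2 =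
      ∑ i, p i * (h i - ∑ j, p j * h j) ^ 2 := by
  set m := ∑ j, p j * h j with hm
  have expand : ∀ i, p i * (h i - m) ^ 2 = p i * h i ^ 2 - 2 * m * (p i * h i) + m ^ 2 * p i :=
    fun i => by ring
  simp only [expand, Finset.sum_add_distrib, Finset.sum_sub_distrib, ← Finset.mul_sum]
  rw [hp, ← hm]
  ring

theorem sum_mul_sum_of_stationary {S : Type*} [Fintype S] {L : S → S → ℝ} {p : S → ℝ}
    (hstat : ∀ j, ∑ i, p i * L i j = p j) (h : S → ℝ) :
    ∑ i, p i * (∑ j, L i j * h j) = ∑ j, p j * h j := by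
  simp only [Finset.mul_sum]
  rw [Finset.sum_comm]
  simp only [← mul_assoc, ← Finset.sum_mul, hstat]

/-- Cauchy–Schwarz with nonnegative weights. -/
theorem sq_sum_mul_le_sum_mul_sum_mul_sq_s4 {S : Type*} [Fintype S] {w : S → ℝ}
    (hw : ∀ j, 0 ≤ w j) (g : S → ℝ) :
    (∑ j, w j * g j) ^ 2 ≤ (∑ j, w j) * ∑ j, w j * g j ^ 2 :=
  Finset.sum_sq_le_sum_mul_sum_of_sq_le_mul _ (fun j _ => hw j)
    (fun j _ => mul_nonneg (hw j) (sq_nonneg _)) (fun j _ => le_of_eq (by ring))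

/-- variance contraction via Mihail's identity and the separation bound,
used in the proof of Corollary 3.1 of the paper.
Let `L` be a row-stochastic matrix on a nonempty finite state space `S`, `π` a strictly
positive stationary probability vector, and `Δ ≥ 1` a real with `L i j ≥ π j / Δ` for
all `i, j`.  Then for every `f : S → ℝ`,
`Var_π(L f) ≤ (1 − 1/Δ) · Var_π(f)`, where `(L f)(i) = ∑_j L i j · f j` and
`Var_π(g) = ∑_i π i · g i² − (∑_i π i · g i)²`. -/
theorem variance_contraction_of_separation
    (S : Type) [Fintype S] [Nonempty S]
    (L : S → S → ℝ) (hL0 : ∀ i j, 0 ≤ L i j) (hL1 : ∀ i, ∑ j, L i j = 1)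
    (π : S → ℝ) (hπpos : ∀ i, 0 < π i) (hπ1 : ∑ i, π i = 1)
    (hstat : ∀ j, ∑ i, π i * L i j = π j)
    (Δ : ℝ) (hΔ : 1 ≤ Δ)
    (hsep : ∀ i j, π j / Δ ≤ L i j) :
    ∀ f : S → ℝ,
      ∑ i, π i * (∑ j, L i j * f j) ^ 2 - (∑ i, π i * (∑ j, L i j * f j)) ^ 2 ≤
        (1 - 1 / Δ) * (∑ i, π i * f i ^ 2 - (∑ i, π i * f i) ^ 2) := by
  intro f
  have hΔ0 : 0 < Δ := by linarith
  rw [sum_mul_sq_sub_sq_sum_mul π _ hπ1, sum_mul_sq_sub_sq_sum_mul π f hπ1,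
    sum_mul_sum_of_stationary hstat f]
  set m := ∑ j, π j * f j with hm
  have hc : 0 ≤ 1 - 1 / Δ := by
    rw [sub_nonneg, div_le_one hΔ0]
    exact hΔ
  have row_bound : ∀ i, (∑ j, L i j * f j - m) ^ 2 ≤
      (1 - 1 / Δ) * ∑ j, L i j * (f j - m) ^ 2 := by
    intro i
    have total : ∑ j, (L i j - π j / Δ) = 1 - 1 / Δ := by
      rw [Finset.sum_sub_distrib, ← Finset.sum_div, hL1, hπ1]
    have centered : ∑ j, (L i j - π j / Δ) * (f j - m) = ∑ j, L i j * f j - m := by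
      have expand : ∀ j, (L i j - π j / Δ) * (f j - m) =
          L i j * f j - 1 / Δ * (π j * f j) - m * (L i j - π j / Δ) := fun j => by ring
      simp only [expand]
      rw [Finset.sum_sub_distrib, Finset.sum_sub_distrib, ← Finset.mul_sum, ← Finset.mul_sum,
        total, ← hm]
      ring
    calc (∑ j, L i j * f j - m) ^ 2
        = (∑ j, (L i j - π j / Δ) * (f j - m)) ^ 2 := by rw [centered]
      _ ≤ (∑ j, (L i j - π j / Δ)) * ∑ j, (L i j - π j / Δ) * (f j - m) ^ 2 :=
          sq_sum_mul_le_sum_mul_sum_mul_sq_s4 (fun j => sub_nonneg.2 (hsep i j)) _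
      _ ≤ (1 - 1 / Δ) * ∑ j, L i j * (f j - m) ^ 2 := by
          rw [total]
          refine mul_le_mul_of_nonneg_left (Finset.sum_le_sum fun j _ => ?_) hc
          exact mul_le_mul_of_nonneg_right
            (sub_le_self _ (div_nonneg (hπpos j).le hΔ0.le)) (sq_nonneg _)
  calc ∑ i, π i * (∑ j, L i j * f j - m) ^ 2
      ≤ ∑ i, π i * ((1 - 1 / Δ) * ∑ j, L i j * (f j - m) ^ 2) :=
        Finset.sum_le_sum fun i _ => mul_le_mul_of_nonneg_left (row_bound i) (hπpos i).le
    _ = (1 - 1 / Δ) * ∑ i, π i * ∑ j, L i j * (f j - m) ^ 2 := by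
        rw [Finset.mul_sum]
        exact Finset.sum_congr rfl fun i _ => by ring
    _ = (1 - 1 / Δ) * ∑ i, π i * (f i - m) ^ 2 := by
        rw [sum_mul_sum_of_stationary hstat]
end

section
/- Let π be a probability vector on a nonempty finite set S and let c ≥ 0. Define ‖f‖ := (max_{i∈S} |f(i)|) + c·√(Var_π(f)) for f : S → ℝ. Then for all f, g : S → ℝ, the pointwise product satisfies ‖f·g‖ ≤ ‖f‖ · ‖g‖. -/
theorem Real.sqrt_sum_mul_sq_le_of_abs_le {ι : Type*} (s : Finset ι) (w u v h : ι → ℝ)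
    (hw : ∀ i, 0 ≤ w i) {a b : ℝ} (ha : 0 ≤ a) (hb : 0 ≤ b)
    (hh : ∀ i, |h i| ≤ a * |u i| + b * |v i|) :
    √(∑ i ∈ s, w i * h i ^ 2) ≤
      a * √(∑ i ∈ s, w i * u i ^ 2) + b * √(∑ i ∈ s, w i * v i ^ 2) := by
  have hu : 0 ≤ ∑ i ∈ s, w i * u i ^ 2 :=
    Finset.sum_nonneg fun i _ => mul_nonneg (hw i) (sq_nonneg _)
  have hv : 0 ≤ ∑ i ∈ s, w i * v i ^ 2 :=
    Finset.sum_nonneg fun i _ => mul_nonneg (hw i) (sq_nonneg _)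
  have hcs : ∑ i ∈ s, w i * (|u i| * |v i|) ≤
      √(∑ i ∈ s, w i * u i ^ 2) * √(∑ i ∈ s, w i * v i ^ 2) := by
    rw [← Real.sqrt_mul hu]
    refine Real.le_sqrt_of_sq_le (Finset.sum_sq_le_sum_mul_sum_of_sq_le_mul s
      (fun i _ => mul_nonneg (hw i) (sq_nonneg _))
      (fun i _ => mul_nonneg (hw i) (sq_nonneg _)) fun i _ => le_of_eq ?_)
    rw [← sq_abs (u i), ← sq_abs (v i)]
    ring
  refine Real.sqrt_le_iff.2 ⟨by positivity, ?_⟩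
  calc ∑ i ∈ s, w i * h i ^ 2
      ≤ ∑ i ∈ s, w i * (a * |u i| + b * |v i|) ^ 2 := by
        refine Finset.sum_le_sum fun i _ => mul_le_mul_of_nonneg_left ?_ (hw i)
        rw [← sq_abs (h i)]
        exact pow_le_pow_left₀ (abs_nonneg _) (hh i) 2
    _ = a ^ 2 * ∑ i ∈ s, w i * u i ^ 2 + b ^ 2 * ∑ i ∈ s, w i * v i ^ 2 +
          2 * (a * b) * ∑ i ∈ s, w i * (|u i| * |v i|) := by
        simp only [Finset.mul_sum, ← Finset.sum_add_distrib]
        refine Finset.sum_congr rfl fun i _ => ?_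
        rw [← sq_abs (u i), ← sq_abs (v i)]
        ring
    _ ≤ a ^ 2 * ∑ i ∈ s, w i * u i ^ 2 + b ^ 2 * ∑ i ∈ s, w i * v i ^ 2 +
          2 * (a * b) * (√(∑ i ∈ s, w i * u i ^ 2) * √(∑ i ∈ s, w i * v i ^ 2)) := by
        gcongr
    _ = (a * √(∑ i ∈ s, w i * u i ^ 2) + b * √(∑ i ∈ s, w i * v i ^ 2)) ^ 2 := by
        rw [add_sq, mul_pow, mul_pow, Real.sq_sqrt hu, Real.sq_sqrt hv]
        ring

theorem weighted_variance_eq_sum_prod {S : Type*} [Fintype S] (π : S → ℝ)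
    (hπ : ∑ i, π i = 1) (f : S → ℝ) :
    ∑ i, π i * f i ^ 2 - (∑ i, π i * f i) ^ 2 =
      ∑ p : S × S, π p.1 * π p.2 / 2 * (f p.1 - f p.2) ^ 2 := by
  have expand : ∀ i j, π i * π j / 2 * (f i - f j) ^ 2 =
      (π i * f i ^ 2) * π j / 2 + π i * (π j * f j ^ 2) / 2 - (π i * f i) * (π j * f j) := by
    intro i j
    ring
  simp only [Fintype.sum_prod_type, expand, Finset.sum_sub_distrib, Finset.sum_add_distrib,
    ← Finset.sum_div, ← Finset.mul_sum, ← Finset.sum_mul, hπ]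
  ring

/-- Lemma A.2 of the paper: Banach algebra property of the norm.
Let `π` be a probability vector on a nonempty finite set `S` and `c ≥ 0`.  Define the
norm `N f := (max_i |f i|) + c·√(Var_π f)` where
`Var_π(f) = ∑_i π i · f i² − (∑_i π i · f i)²`.  Then for all `f, g : S → ℝ`, the
pointwise product satisfies `N (f·g) ≤ N f · N g`. -/
theorem norm_banach_algebra
    (S : Type) [Fintype S] [Nonempty S]
    (π : S → ℝ) (hπ0 : ∀ i, 0 ≤ π i) (hπ1 : ∑ i, π i = 1)
    (c : ℝ) (hc : 0 ≤ c)
    (N : (S → ℝ) → ℝ)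
    (hN : ∀ f, N f = (⨆ i, |f i|) +
      c * Real.sqrt (∑ i, π i * f i ^ 2 - (∑ i, π i * f i) ^ 2)) :
    ∀ f g : S → ℝ, N (fun i => f i * g i) ≤ N f * N g := by
  intro f g
  have le_sup : ∀ (f : S → ℝ) i, |f i| ≤ ⨆ i, |f i| := fun f i =>
    le_ciSup (f := fun i => |f i|) (Set.finite_range _).bddAbove i
  have sup_nonneg : ∀ f : S → ℝ, 0 ≤ ⨆ i, |f i| := fun f =>
    Real.iSup_nonneg fun i => abs_nonneg (f i)
  have hsup : ⨆ i, |f i * g i| ≤ (⨆ i, |f i|) * ⨆ i, |g i| := ciSup_le fun i => by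
    rw [abs_mul]
    exact mul_le_mul (le_sup f i) (le_sup g i) (abs_nonneg _) (sup_nonneg f)
  have hvar := Real.sqrt_sum_mul_sq_le_of_abs_le Finset.univ
    (fun p : S × S => π p.1 * π p.2 / 2) (fun p => g p.1 - g p.2) (fun p => f p.1 - f p.2)
    (fun p => f p.1 * g p.1 - f p.2 * g p.2)
    (fun p => div_nonneg (mul_nonneg (hπ0 _) (hπ0 _)) zero_le_two)
    (sup_nonneg f) (sup_nonneg g) (fun p => by
      calc |f p.1 * g p.1 - f p.2 * g p.2|
          = |f p.1 * (g p.1 - g p.2) + g p.2 * (f p.1 - f p.2)| := by ring_nf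
        _ ≤ |f p.1| * |g p.1 - g p.2| + |g p.2| * |f p.1 - f p.2| := by
          simpa only [abs_mul] using
            abs_add_le (f p.1 * (g p.1 - g p.2)) (g p.2 * (f p.1 - f p.2))
        _ ≤ _ := by
          gcongr
          · exact le_sup f _
          · exact le_sup g _)
  simp only [hN, weighted_variance_eq_sum_prod π hπ1]
  have hcross := mul_nonneg (mul_nonneg hc hc) (mul_nonneg
    (Real.sqrt_nonneg (∑ p : S × S, π p.1 * π p.2 / 2 * (f p.1 - f p.2) ^ 2))
    (Real.sqrt_nonneg (∑ p : S × S, π p.1 * π p.2 / 2 * (g p.1 - g p.2) ^ 2)))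
  linarith [mul_le_mul_of_nonneg_left hvar hc]
end

section
/- Let π be a probability vector on a nonempty finite set S. Then for all f, g : S → ℝ, √(Var_π(f·g)) ≤ (max_{i∈S} |f(i)|)·√(Var_π(g)) + (max_{i∈S} |g(i)|)·√(Var_π(f)), where f·g denotes the pointwise product. -/
/-- Minkowski's inequality for a weighted `ℓ²` seminorm. -/
theorem sqrt_sum_mul_sq_le_add {ι : Type*} [Fintype ι] (w a b c : ι → ℝ) (hw : ∀ i, 0 ≤ w i)
    (hc : ∀ i, |c i| ≤ |a i| + |b i|) :
    √(∑ i, w i * c i ^ 2) ≤ √(∑ i, w i * a i ^ 2) + √(∑ i, w i * b i ^ 2) := by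
  have ha : 0 ≤ ∑ i, w i * a i ^ 2 := Finset.sum_nonneg fun i _ => mul_nonneg (hw i) (sq_nonneg _)
  have hb : 0 ≤ ∑ i, w i * b i ^ 2 := Finset.sum_nonneg fun i _ => mul_nonneg (hw i) (sq_nonneg _)
  have cauchy_schwarz :
      ∑ i, w i * (|a i| * |b i|) ≤ √(∑ i, w i * a i ^ 2) * √(∑ i, w i * b i ^ 2) := by
    rw [← Real.sqrt_mul ha]
    refine Real.le_sqrt_of_sq_le (Finset.sum_sq_le_sum_mul_sum_of_sq_le_mul _
      (fun i _ => mul_nonneg (hw i) (sq_nonneg _)) (fun i _ => mul_nonneg (hw i) (sq_nonneg _))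
      fun i _ => le_of_eq ?_)
    rw [← sq_abs (a i), ← sq_abs (b i)]
    ring
  refine Real.sqrt_le_iff.2 ⟨by positivity, ?_⟩
  calc ∑ i, w i * c i ^ 2
      ≤ ∑ i, w i * (|a i| + |b i|) ^ 2 := by
        refine Finset.sum_le_sum fun i _ => mul_le_mul_of_nonneg_left ?_ (hw i)
        rw [← sq_abs (c i)]
        exact pow_le_pow_left₀ (abs_nonneg _) (hc i) 2
    _ = ∑ i, w i * a i ^ 2 + ∑ i, w i * b i ^ 2 + 2 * ∑ i, w i * (|a i| * |b i|) := by
        rw [Finset.mul_sum, ← Finset.sum_add_distrib, ← Finset.sum_add_distrib]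
        refine Finset.sum_congr rfl fun i _ => ?_
        rw [← sq_abs (a i), ← sq_abs (b i)]
        ring
    _ ≤ (√(∑ i, w i * a i ^ 2) + √(∑ i, w i * b i ^ 2)) ^ 2 := by
        rw [add_sq, Real.sq_sqrt ha, Real.sq_sqrt hb]
        linarith

theorem sqrt_sum_mul_const_mul_sq {ι : Type*} [Fintype ι] (w a : ι → ℝ) {C : ℝ} (hC : 0 ≤ C) :
    √(∑ i, w i * (C * a i) ^ 2) = C * √(∑ i, w i * a i ^ 2) := by
  rw [← Real.sqrt_sq hC, ← Real.sqrt_mul (sq_nonneg C), Real.sqrt_sq hC, Finset.mul_sum]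
  congr 1
  exact Finset.sum_congr rfl fun i _ => by ring

/-- The variance as a sum of squared differences over pairs of points. -/
theorem sum_mul_sq_sub_sq_sum_eq_sum_prod {S : Type*} [Fintype S] (π h : S → ℝ)
    (hπ1 : ∑ i, π i = 1) :
    ∑ i, π i * h i ^ 2 - (∑ i, π i * h i) ^ 2 =
      ∑ p : S × S, π p.1 * π p.2 / 2 * (h p.1 - h p.2) ^ 2 := by
  have expand (i j : S) : π i * π j / 2 * (h i - h j) ^ 2 =
      (π i * h i ^ 2) * π j / 2 + π i * (π j * h j ^ 2) / 2 - (π i * h i) * (π j * h j) := by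
    ring
  simp only [Fintype.sum_prod_type, expand, Finset.sum_add_distrib, Finset.sum_sub_distrib,
    ← Finset.sum_div, ← Finset.mul_sum, ← Finset.sum_mul, hπ1]
  ring

/-- the key inequality in the proof of Lemma A.2 of the paper.
Let `π` be a probability vector on a nonempty finite set `S`.  Then for all
`f, g : S → ℝ`, with `Var_π(h) = ∑_i π i · h i² − (∑_i π i · h i)²` and `f·g` the
pointwise product,
`√(Var_π(f·g)) ≤ (max_i |f i|)·√(Var_π g) + (max_i |g i|)·√(Var_π f)`. -/
theorem sqrt_variance_of_product_le
    (S : Type) [Fintype S] [Nonempty S]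
    (π : S → ℝ) (hπ0 : ∀ i, 0 ≤ π i) (hπ1 : ∑ i, π i = 1) :
    ∀ f g : S → ℝ,
      Real.sqrt (∑ i, π i * (f i * g i) ^ 2 - (∑ i, π i * (f i * g i)) ^ 2) ≤
        (⨆ i, |f i|) * Real.sqrt (∑ i, π i * g i ^ 2 - (∑ i, π i * g i) ^ 2) +
        (⨆ i, |g i|) * Real.sqrt (∑ i, π i * f i ^ 2 - (∑ i, π i * f i) ^ 2) := by
  intro f g
  have hf (i : S) : |f i| ≤ ⨆ i, |f i| := le_ciSup (Set.finite_range fun i => |f i|).bddAbove i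
  have hg (i : S) : |g i| ≤ ⨆ i, |g i| := le_ciSup (Set.finite_range fun i => |g i|).bddAbove i
  have hF : 0 ≤ ⨆ i, |f i| := Real.iSup_nonneg fun i => abs_nonneg (f i)
  have hG : 0 ≤ ⨆ i, |g i| := Real.iSup_nonneg fun i => abs_nonneg (g i)
  rw [sum_mul_sq_sub_sq_sum_eq_sum_prod π (fun i => f i * g i) hπ1,
    sum_mul_sq_sub_sq_sum_eq_sum_prod π f hπ1, sum_mul_sq_sub_sq_sum_eq_sum_prod π g hπ1,
    ← sqrt_sum_mul_const_mul_sq _ _ hF, ← sqrt_sum_mul_const_mul_sq _ _ hG]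
  refine sqrt_sum_mul_sq_le_add _ _ _ _
    (fun p => div_nonneg (mul_nonneg (hπ0 p.1) (hπ0 p.2)) zero_le_two) fun p => ?_
  calc |f p.1 * g p.1 - f p.2 * g p.2|
      = |f p.1 * (g p.1 - g p.2) + g p.2 * (f p.1 - f p.2)| := by ring_nf
    _ ≤ |f p.1| * |g p.1 - g p.2| + |g p.2| * |f p.1 - f p.2| := by
        simpa only [abs_mul] using
          abs_add_le (f p.1 * (g p.1 - g p.2)) (g p.2 * (f p.1 - f p.2))
    _ ≤ (⨆ i, |f i|) * |g p.1 - g p.2| + (⨆ i, |g i|) * |f p.1 - f p.2| := by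
        gcongr
        · exact hf p.1
        · exact hg p.2
    _ = |(⨆ i, |f i|) * (g p.1 - g p.2)| + |(⨆ i, |g i|) * (f p.1 - f p.2)| := by
        rw [abs_mul, abs_mul, abs_of_nonneg hF, abs_of_nonneg hG]
end

section
/- Let P be a row-stochastic matrix on a nonempty finite state space S, let π be a probability vector on S with πP = π, and let s ∈ [0,1] satisfy P(x,y) ≥ (1−s)·π(y) for all x, y ∈ S. Then for every f : S → ℝ, the stationary covariance satisfies ∑_{x,y} π(x) f(x) P(x,y) f(y) − (∑_x π(x) f(x))² ≤ s · Var_π(f). -/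
/-- The Dirichlet form of a stochastic kernel with stationary weights `π`, expanded. -/
theorem sum_stationary_mul_sub_sq {S : Type*} [Fintype S] (K : S → S → ℝ) (π f : S → ℝ)
    (hK : ∀ x, ∑ y, K x y = 1) (hstat : ∀ y, ∑ x, π x * K x y = π y) :
    ∑ x, ∑ y, π x * K x y * (f x - f y) ^ 2 =
      2 * (∑ x, π x * f x ^ 2 - ∑ x, ∑ y, π x * f x * K x y * f y) := by
  have hleft : ∑ x, ∑ y, π x * f x ^ 2 * K x y = ∑ x, π x * f x ^ 2 := by
    simp_rw [← Finset.mul_sum, hK, mul_one]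
  have hright : ∑ x, ∑ y, π x * K x y * f y ^ 2 = ∑ x, π x * f x ^ 2 := by
    rw [Finset.sum_comm]
    simp_rw [← Finset.sum_mul, hstat]
  have hexpand : ∑ x, ∑ y, π x * K x y * (f x - f y) ^ 2 =
      ∑ x, ∑ y, π x * f x ^ 2 * K x y + ∑ x, ∑ y, π x * K x y * f y ^ 2 -
        2 * ∑ x, ∑ y, π x * f x * K x y * f y := by
    simp_rw [Finset.mul_sum, ← Finset.sum_add_distrib, ← Finset.sum_sub_distrib]
    refine Finset.sum_congr rfl fun x _ => Finset.sum_congr rfl fun y _ => ?_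
    ring
  rw [hexpand, hleft, hright]
  ring

/-- Lemma A.6 of the paper: covariance and separation.
Let `P` be a row-stochastic matrix on a nonempty finite state space `S`, `π` a
stationary probability vector, and `s ∈ [0,1]` with the Doeblin bound
`P x y ≥ (1 − s)·π y` for all `x, y`.  Then for every `f : S → ℝ`, the stationary
covariance satisfies
`∑_{x,y} π x · f x · P x y · f y − (∑_x π x · f x)² ≤ s · Var_π(f)`, where
`Var_π(f) = ∑_x π x · f x² − (∑_x π x · f x)²`. -/
theorem covariance_le_separation_mul_variance
    (S : Type) [Fintype S] [Nonempty S]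
    (P : S → S → ℝ) (hP0 : ∀ x y, 0 ≤ P x y) (hP1 : ∀ x, ∑ y, P x y = 1)
    (π : S → ℝ) (hπ0 : ∀ x, 0 ≤ π x) (hπ1 : ∑ x, π x = 1)
    (hstat : ∀ y, ∑ x, π x * P x y = π y)
    (s : ℝ) (hs0 : 0 ≤ s) (hs1 : s ≤ 1)
    (hdoeblin : ∀ x y, (1 - s) * π y ≤ P x y) :
    ∀ f : S → ℝ,
      (∑ x, ∑ y, π x * f x * P x y * f y) - (∑ x, π x * f x) ^ 2 ≤
        s * (∑ x, π x * f x ^ 2 - (∑ x, π x * f x) ^ 2) := by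
  intro f
  have hP := sum_stationary_mul_sub_sq P π f hP1 hstat
  have hπ := sum_stationary_mul_sub_sq (fun _ y => π y) π f (fun _ => hπ1)
    (fun y => by rw [← Finset.sum_mul, hπ1, one_mul])
  have hprod : ∑ x, ∑ y, π x * f x * π y * f y = (∑ x, π x * f x) ^ 2 := by
    simp_rw [sq, Finset.sum_mul_sum, mul_assoc]
  have hle : (1 - s) * ∑ x, ∑ y, π x * π y * (f x - f y) ^ 2 ≤
      ∑ x, ∑ y, π x * P x y * (f x - f y) ^ 2 := by
    simp_rw [Finset.mul_sum]
    refine Finset.sum_le_sum fun x _ => Finset.sum_le_sum fun y _ => ?_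
    calc (1 - s) * (π x * π y * (f x - f y) ^ 2)
        = π x * ((1 - s) * π y) * (f x - f y) ^ 2 := by ring
      _ ≤ π x * P x y * (f x - f y) ^ 2 := by
        have := hπ0 x
        have := hdoeblin x y
        gcongr
  rw [hP, hπ, hprod] at hle
  linarith
end

section
/- Let P be a row-stochastic matrix on a nonempty finite state space S, let π be a probability vector on S with πP = π, and let Δ ≥ 1 be a real number such that for every t ≥ 1 and all x, y ∈ S, P^t(x,y) ≥ (1 − (1 − 1/Δ)^t)·π(y). For f : S → ℝ set C_t(f) := ∑_{x,y} π(x) f(x) P^t(x,y) f(y) − (∑_x π(x) f(x))². Then for every n ≥ 1, n·Var_π(f) + 2·∑_{t=1}^{n−1} (n−t)·C_t(f) ≤ (2Δ − 1)·n·Var_π(f). -/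
/-- Powers of a matrix whose rows sum to one have rows summing to one. -/
lemma sum_row_pow_eq_one {S : Type*} [Fintype S] [DecidableEq S] {P : Matrix S S ℝ}
    (hP : ∀ x, ∑ y, P x y = 1) (t : ℕ) (x : S) : ∑ y, (P ^ t) x y = 1 := by
  induction t generalizing x with
  | zero => simp [Matrix.one_apply]
  | succ t ih =>
    simp only [pow_succ, Matrix.mul_apply]
    rw [Finset.sum_comm]
    simp [← Finset.mul_sum, hP, ih]

/-- A stationary vector of a matrix is stationary for all its powers. -/
lemma sum_mul_pow_eq_self {S : Type*} [Fintype S] [DecidableEq S] {P : Matrix S S ℝ}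
    {π : S → ℝ} (hπ : ∀ y, ∑ x, π x * P x y = π y) (t : ℕ) (y : S) :
    ∑ x, π x * (P ^ t) x y = π y := by
  induction t generalizing y with
  | zero => simp [Matrix.one_apply]
  | succ t ih =>
    simp only [pow_succ, Matrix.mul_apply, Finset.mul_sum]
    rw [Finset.sum_comm]
    simp only [← mul_assoc, ← Finset.sum_mul, ih, hπ]

/-- The Dirichlet form identity for a row-stochastic matrix with stationary vector `π`. -/
lemma sum_mul_sub_sq_eq {S : Type*} [Fintype S] {Q : Matrix S S ℝ} {π : S → ℝ}
    (hQ : ∀ x, ∑ y, Q x y = 1) (hπ : ∀ y, ∑ x, π x * Q x y = π y) (f : S → ℝ) :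
    ∑ x, ∑ y, π x * Q x y * (f x - f y) ^ 2 =
      2 * ∑ x, π x * f x ^ 2 - 2 * ∑ x, ∑ y, π x * f x * Q x y * f y := by
  have h : ∑ x, ∑ y, π x * Q x y * f y ^ 2 = ∑ x, π x * f x ^ 2 := by
    rw [Finset.sum_comm]
    simp [← Finset.sum_mul, hπ]
  calc
    _ = ∑ x, ∑ y, (π x * f x ^ 2 * Q x y + π x * Q x y * f y ^ 2
          - 2 * (π x * f x * Q x y * f y)) :=
      Finset.sum_congr rfl fun x _ => Finset.sum_congr rfl fun y _ => by ring
    _ = _ := by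
      simp only [Finset.sum_sub_distrib, Finset.sum_add_distrib, ← Finset.mul_sum, hQ, mul_one, h]
      ring

/-- The Dirichlet form identity for the chain of independent samples from `π`. -/
lemma sum_mul_mul_sub_sq_eq {S : Type*} [Fintype S] {π : S → ℝ} (hπ : ∑ x, π x = 1)
    (f : S → ℝ) :
    ∑ x, ∑ y, π x * π y * (f x - f y) ^ 2 =
      2 * (∑ x, π x * f x ^ 2 - (∑ x, π x * f x) ^ 2) := by
  have h := sum_mul_sub_sq_eq (Q := fun _ y => π y) (π := π) (fun _ => hπ)
    (fun y => by rw [← Finset.sum_mul, hπ, one_mul]) f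
  have hm : ∑ x, ∑ y, π x * f x * π y * f y = (∑ x, π x * f x) ^ 2 := by
    rw [sq, Finset.sum_mul_sum]
    exact Finset.sum_congr rfl fun x _ => Finset.sum_congr rfl fun y _ => by ring
  rw [h, hm]
  ring

/-- If a row-stochastic `Q` with stationary `π` dominates `(1 - a) π`, then the covariance of `f`
along one step of `Q` is at most `a` times the variance of `f`. -/
lemma covariance_le_mul_variance {S : Type*} [Fintype S] {Q : Matrix S S ℝ} {π : S → ℝ}
    (hQ : ∀ x, ∑ y, Q x y = 1) (hπ0 : ∀ x, 0 ≤ π x) (hπ1 : ∑ x, π x = 1)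
    (hπ : ∀ y, ∑ x, π x * Q x y = π y) {a : ℝ} (ha : ∀ x y, (1 - a) * π y ≤ Q x y)
    (f : S → ℝ) :
    (∑ x, ∑ y, π x * f x * Q x y * f y) - (∑ x, π x * f x) ^ 2 ≤
      a * (∑ x, π x * f x ^ 2 - (∑ x, π x * f x) ^ 2) := by
  have h : (1 - a) * ∑ x, ∑ y, π x * π y * (f x - f y) ^ 2 ≤
      ∑ x, ∑ y, π x * Q x y * (f x - f y) ^ 2 := by
    simp only [Finset.mul_sum]
    refine Finset.sum_le_sum fun x _ => Finset.sum_le_sum fun y _ => ?_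
    calc
      _ = π x * ((1 - a) * π y) * (f x - f y) ^ 2 := by ring
      _ ≤ _ := by
        have := hπ0 x
        have := ha x y
        gcongr
  rw [sum_mul_mul_sub_sq_eq hπ1, sum_mul_sub_sq_eq hQ hπ] at h
  linarith

/-- A truncated geometric sum with ratio `1 - 1 / Δ`. -/
lemma sum_Ico_one_sub_inv_pow {Δ : ℝ} (hΔ : Δ ≠ 0) {n : ℕ} (hn : 1 ≤ n) :
    ∑ t ∈ Finset.Ico 1 n, (1 - 1 / Δ) ^ t = Δ - 1 - Δ * (1 - 1 / Δ) ^ n := by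
  induction n, hn using Nat.le_induction with
  | base =>
    simp only [Finset.Ico_self, Finset.sum_empty, pow_one]
    field_simp
    ring
  | succ n hn ih =>
    have h : Δ * (1 - 1 / Δ) = Δ - 1 := by field_simp
    rw [Finset.sum_Ico_succ_top hn, ih, pow_succ]
    linear_combination (1 - 1 / Δ) ^ n * h


/-- finite-time form of the upper bound in Lemma 4.1 of the paper.
Let `P` be a row-stochastic matrix on a nonempty finite state space `S`, `π` a
stationary probability vector, and `Δ ≥ 1` real such that for every `t ≥ 1`,
`(P^t) x y ≥ (1 − (1 − 1/Δ)^t)·π y`.  With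
`V = Var_π(f) = ∑_x π x · f x² − (∑_x π x · f x)²` and
`C t = ∑_{x,y} π x · f x · (P^t) x y · f y − (∑_x π x · f x)²`, for every `n ≥ 1`
`n·V + 2·∑_{t=1}^{n−1} (n − t)·C t ≤ (2Δ − 1)·n·V`. -/
theorem ergodic_sum_variance_upper_bound
    (S : Type) [Fintype S] [DecidableEq S] [Nonempty S]
    (P : Matrix S S ℝ) (hP0 : ∀ x y, 0 ≤ P x y) (hP1 : ∀ x, ∑ y, P x y = 1)
    (π : S → ℝ) (hπ0 : ∀ x, 0 ≤ π x) (hπ1 : ∑ x, π x = 1)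
    (hstat : ∀ y, ∑ x, π x * P x y = π y)
    (Δ : ℝ) (hΔ : 1 ≤ Δ)
    (hsep : ∀ t : ℕ, 1 ≤ t → ∀ x y, (1 - (1 - 1 / Δ) ^ t) * π y ≤ (P ^ t) x y)
    (f : S → ℝ)
    (V : ℝ) (hV : V = ∑ x, π x * f x ^ 2 - (∑ x, π x * f x) ^ 2)
    (C : ℕ → ℝ)
    (hC : ∀ t, C t = (∑ x, ∑ y, π x * f x * (P ^ t) x y * f y) - (∑ x, π x * f x) ^ 2) :
    ∀ n : ℕ, 1 ≤ n →
      n * V + 2 * ∑ t ∈ Finset.Ico 1 n, ((n : ℝ) - t) * C t ≤ (2 * Δ - 1) * n * V := by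
  intro n hn
  have hΔ0 : 0 < Δ := by linarith
  have hr : 0 ≤ 1 - 1 / Δ := sub_nonneg.2 ((div_le_one hΔ0).2 hΔ)
  have hV0 : 0 ≤ V := by
    have h : 0 ≤ ∑ x, ∑ y, π x * π y * (f x - f y) ^ 2 :=
      Finset.sum_nonneg fun x _ => Finset.sum_nonneg fun y _ =>
        mul_nonneg (mul_nonneg (hπ0 x) (hπ0 y)) (sq_nonneg _)
    rw [sum_mul_mul_sub_sq_eq hπ1, ← hV] at h
    linarith
  have hCle : ∀ t, 1 ≤ t → C t ≤ (1 - 1 / Δ) ^ t * V := fun t ht => by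
    rw [hC, hV]
    exact covariance_le_mul_variance (sum_row_pow_eq_one hP1 t) hπ0 hπ1
      (sum_mul_pow_eq_self hstat t) (hsep t ht) f
  have hsum : ∑ t ∈ Finset.Ico 1 n, ((n : ℝ) - t) * C t ≤
      n * V * ∑ t ∈ Finset.Ico 1 n, (1 - 1 / Δ) ^ t := by
    rw [Finset.mul_sum]
    refine Finset.sum_le_sum fun t ht => ?_
    obtain ⟨ht1, htn⟩ := Finset.mem_Ico.1 ht
    have htn' : (0 : ℝ) ≤ n - t := sub_nonneg.2 (by exact_mod_cast htn.le)
    calc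
      ((n : ℝ) - t) * C t ≤ (n - t) * ((1 - 1 / Δ) ^ t * V) :=
        mul_le_mul_of_nonneg_left (hCle t ht1) htn'
      _ ≤ n * ((1 - 1 / Δ) ^ t * V) :=
        mul_le_mul_of_nonneg_right (sub_le_self _ t.cast_nonneg)
          (mul_nonneg (pow_nonneg hr t) hV0)
      _ = _ := by ring
  have hgeom : ∑ t ∈ Finset.Ico 1 n, (1 - 1 / Δ) ^ t ≤ Δ - 1 := by
    rw [sum_Ico_one_sub_inv_pow hΔ0.ne' hn]
    exact sub_le_self _ (mul_nonneg hΔ0.le (pow_nonneg hr n))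
  have := mul_le_mul_of_nonneg_left hgeom (mul_nonneg n.cast_nonneg hV0 : 0 ≤ (n : ℝ) * V)
  linarith
end

section
/- Let m ≥ 1 and let q be a probability vector on {1,…,m}, i.e. q_i ∈ [0,1] with ∑_{i=1}^m q_i = 1. Then ∑_{i=1}^m q_i (log q_i)² ≤ max(4, (log m)²), where a term with q_i = 0 contributes 0 (as with Real.log 0 = 0). -/
/-- A second-order lower bound for `exp` on `[-L, ∞)`, valid when `2 ≤ L`. -/
lemma sq_le_two_mul_exp_sub_one_sub {L s : ℝ} (hL : 2 ≤ L) (hs : -L ≤ s) :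
    s ^ 2 ≤ 2 * L * (Real.exp s - 1 - s) := by
  have h0 : 0 ≤ Real.exp s - 1 - s := by linarith [Real.add_one_le_exp s]
  rcases le_total 0 s with h | h
  · nlinarith [Real.quadratic_le_exp_of_nonneg h]
  rcases le_total (-2) s with h2 | h2
  · have h_half : 1 + s / 2 ≤ Real.exp (s / 2) := by linarith [Real.add_one_le_exp (s / 2)]
    have h_sq : (1 + s / 2) ^ 2 ≤ Real.exp s := by
      calc (1 + s / 2) ^ 2 ≤ Real.exp (s / 2) ^ 2 := by gcongr; linarith
        _ = Real.exp s := by rw [← Real.exp_nat_mul]; congr 1; push_cast; ring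
    nlinarith
  · nlinarith [Real.exp_pos s]

/-- On `[0, 1]`, the function `x * (log x) ^ 2` lies below its tangent line at `exp (-L)`,
when `2 ≤ L`. -/
lemma mul_log_sq_le_tangent {L x : ℝ} (hL : 2 ≤ L) (hx0 : 0 ≤ x) (hx1 : x ≤ 1) :
    x * Real.log x ^ 2 ≤ 2 * L * Real.exp (-L) + (L ^ 2 - 2 * L) * x := by
  rcases hx0.eq_or_lt with rfl | hx
  · simp only [zero_mul, mul_zero, add_zero]
    positivity
  have hs : -L ≤ -Real.log x - L := by linarith [Real.log_nonpos hx0 hx1]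
  have key := mul_le_mul_of_nonneg_left (sq_le_two_mul_exp_sub_one_sub hL hs) hx0
  have hexp : x * Real.exp (-Real.log x - L) = Real.exp (-L) := by
    rw [sub_eq_add_neg, Real.exp_add, Real.exp_neg, Real.exp_log hx, mul_inv_cancel_left₀ hx.ne']
  rw [← hexp]
  linarith

/-- Lemma A.4 of the paper.
Let `m ≥ 1` and `q` a probability vector on `{1,…,m}` (entries in `[0,1]` summing
to `1`).  Then `∑_i q i · (log (q i))² ≤ max 4 (log m)²`, with the convention
`Real.log 0 = 0` so a term with `q i = 0` contributes `0`. -/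
theorem second_log_moment_le
    (m : ℕ) (hm : 1 ≤ m)
    (q : Fin m → ℝ) (hq : ∀ i, 0 ≤ q i ∧ q i ≤ 1) (hq1 : ∑ i, q i = 1) :
    ∑ i, q i * (Real.log (q i)) ^ 2 ≤ max 4 ((Real.log m) ^ 2) := by
  set L := max 2 (Real.log m) with hLdef
  have hL : 2 ≤ L := le_max_left _ _
  have hm0 : (0 : ℝ) < m := by exact_mod_cast hm
  have hmL : (m : ℝ) * Real.exp (-L) ≤ 1 := by
    have h : (m : ℝ) ≤ Real.exp L := (Real.log_le_iff_le_exp hm0).1 (le_max_right _ _)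
    rw [Real.exp_neg, ← div_eq_mul_inv]
    exact (div_le_one (Real.exp_pos L)).2 h
  have hL2 : L ^ 2 ≤ max 4 (Real.log m ^ 2) := by
    rcases max_choice 2 (Real.log m) with h | h
    · rw [hLdef, h]
      exact le_max_of_le_left (by norm_num)
    · rw [hLdef, h]
      exact le_max_right _ _
  calc ∑ i, q i * Real.log (q i) ^ 2
      ≤ ∑ i, (2 * L * Real.exp (-L) + (L ^ 2 - 2 * L) * q i) :=
        Finset.sum_le_sum fun i _ => mul_log_sq_le_tangent hL (hq i).1 (hq i).2
    _ = 2 * L * (m * Real.exp (-L)) + (L ^ 2 - 2 * L) := by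
        rw [Finset.sum_add_distrib, Finset.sum_const, Finset.card_univ, Fintype.card_fin,
          nsmul_eq_mul, ← Finset.mul_sum, hq1]
        ring
    _ ≤ L ^ 2 := by nlinarith
    _ ≤ max 4 (Real.log m ^ 2) := hL2
end

section
/- Suppose p ∈ 𝒫 is strictly positive and maximises the entropy rate q ↦ μ_q over 𝒫. Let q ∈ 𝒫 and set ε_i := |1 − q_i/p_i|, and assume max_{i∈{1,…,I}} ε_i ≤ 1/2. Then, with ‖ε‖²_{2,π} := ∑_{i=1}^I π_p(i) ε_i², we have μ_p − ‖ε‖²_{2,π} ≤ μ_q ≤ μ_p − (1/3)·‖ε‖²_{2,π}. -/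
lemma one_add_mul_log_one_add_le {x : ℝ} (hx : |x| ≤ 1 / 2) :
    (1 + x) * Real.log (1 + x) ≤ x + x ^ 2 := by
  have h := abs_le.mp hx
  have hpos : 0 < 1 + x := by linarith
  have hlog := Real.log_le_sub_one_of_pos hpos
  nlinarith [mul_le_mul_of_nonneg_left hlog hpos.le]

lemma le_one_add_mul_log_one_add {x : ℝ} (hx : |x| ≤ 1 / 2) :
    x + x ^ 2 / 3 ≤ (1 + x) * Real.log (1 + x) := by
  have h := abs_le.mp hx
  rcases le_total 0 x with h0 | h0
  · have hlog := mul_le_mul_of_nonneg_left (Real.le_log_one_add_of_nonneg h0)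
      (by linarith : 0 ≤ 1 + x)
    refine le_trans ?_ hlog
    rw [mul_div_assoc', le_div_iff₀ (by linarith)]
    nlinarith [mul_nonneg (sq_nonneg x) (by linarith : 0 ≤ 1 - x)]
  · obtain ⟨s, rfl⟩ : ∃ s, x = -s := ⟨-x, by ring⟩
    have hs : 0 ≤ s := by linarith
    have hlog := (abs_le.mp (Real.abs_log_sub_add_sum_range_le
      (x := s) (by rw [abs_of_nonneg hs]; linarith) 3)).1
    rw [abs_of_nonneg hs] at hlog
    norm_num [Finset.sum_range_succ] at hlog
    rw [← sub_eq_add_neg]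
    have hpos : 0 < 1 - s := by linarith
    have hmul := mul_le_mul_of_nonneg_left hlog hpos.le
    have hcancel : (1 - s) * (s ^ 4 / (1 - s)) = s ^ 4 := by field_simp
    have hquad : 0 ≤ s ^ 2 * (1 / 6 + s / 6 - 2 * s ^ 2 / 3) :=
      mul_nonneg (sq_nonneg s) (by nlinarith)
    nlinarith

/-- Expansion of a weighted entropy along a multiplicative perturbation. -/
lemma sum_mul_log_inv_perturb {ι : Type*} [Fintype ι] (c p d : ι → ℝ)
    (hp : ∀ i, 0 < p i) (hd : ∀ i, |d i| ≤ 1 / 2) :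
    ∑ i, c i * (p i * (1 + d i)) * Real.log (1 / (p i * (1 + d i))) =
      ∑ i, c i * p i * Real.log (1 / p i) - ∑ i, c i * p i * d i * Real.log (p i)
        - ∑ i, c i * p i * ((1 + d i) * Real.log (1 + d i)) := by
  rw [← Finset.sum_sub_distrib, ← Finset.sum_sub_distrib]
  refine Finset.sum_congr rfl fun i _ => ?_
  have h := abs_le.mp (hd i)
  have h1 : 1 + d i ≠ 0 := by linarith
  rw [one_div, one_div, Real.log_inv, Real.log_inv, Real.log_mul (hp i).ne' h1]
  ring

lemma sum_mul_log_inv_perturb_ge {ι : Type*} [Fintype ι] (c p d : ι → ℝ)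
    (hc : ∀ i, 0 ≤ c i) (hp : ∀ i, 0 < p i) (hd : ∀ i, |d i| ≤ 1 / 2)
    (hsum : ∑ i, c i * p i * d i = 0) :
    ∑ i, c i * p i * Real.log (1 / p i) - ∑ i, c i * p i * d i * Real.log (p i)
        - ∑ i, c i * p i * d i ^ 2 ≤
      ∑ i, c i * (p i * (1 + d i)) * Real.log (1 / (p i * (1 + d i))) := by
  rw [sum_mul_log_inv_perturb c p d hp hd]
  have h : ∑ i, c i * p i * ((1 + d i) * Real.log (1 + d i)) ≤
      ∑ i, c i * p i * (d i + d i ^ 2) :=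
    Finset.sum_le_sum fun i _ => mul_le_mul_of_nonneg_left
      (one_add_mul_log_one_add_le (hd i)) (mul_nonneg (hc i) (hp i).le)
  simp only [mul_add (_ * _), Finset.sum_add_distrib, hsum] at h
  linarith

lemma sum_mul_log_inv_perturb_le {ι : Type*} [Fintype ι] (c p d : ι → ℝ)
    (hc : ∀ i, 0 ≤ c i) (hp : ∀ i, 0 < p i) (hd : ∀ i, |d i| ≤ 1 / 2)
    (hsum : ∑ i, c i * p i * d i = 0) :
    ∑ i, c i * (p i * (1 + d i)) * Real.log (1 / (p i * (1 + d i))) ≤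
      ∑ i, c i * p i * Real.log (1 / p i) - ∑ i, c i * p i * d i * Real.log (p i)
        - (1 / 3) * ∑ i, c i * p i * d i ^ 2 := by
  rw [sum_mul_log_inv_perturb c p d hp hd, Finset.mul_sum]
  have h : ∑ i, c i * p i * (d i + d i ^ 2 / 3) ≤
      ∑ i, c i * p i * ((1 + d i) * Real.log (1 + d i)) :=
    Finset.sum_le_sum fun i _ => mul_le_mul_of_nonneg_left
      (le_one_add_mul_log_one_add (hd i)) (mul_nonneg (hc i) (hp i).le)
  have hexp : ∑ i, c i * p i * (d i + d i ^ 2 / 3) =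
      ∑ i, c i * p i * d i + ∑ i, 1 / 3 * (c i * p i * d i ^ 2) := by
    rw [← Finset.sum_add_distrib]
    exact Finset.sum_congr rfl fun i _ => by ring
  linarith

lemma eq_zero_of_forall_abs_le_one_quadratic_nonneg {L S : ℝ} (hS : 0 ≤ S)
    (h : ∀ t : ℝ, |t| ≤ 1 → 0 ≤ t * L + t ^ 2 * S) : L = 0 := by
  have hK : 0 < |L| + S + 1 := by positivity
  have ht := h (-L / (|L| + S + 1)) (by
    rw [abs_div, abs_neg, abs_of_pos hK, div_le_one hK]
    linarith)
  have hrw : -L / (|L| + S + 1) * L + (-L / (|L| + S + 1)) ^ 2 * S =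
      -(L ^ 2 * (|L| + 1)) / (|L| + S + 1) ^ 2 := by
    field_simp
    ring
  rw [hrw, div_nonneg_iff] at ht
  have hK2 : 0 < (|L| + S + 1) ^ 2 := by positivity
  by_contra hL
  have : 0 < L ^ 2 * (|L| + 1) := by positivity
  rcases ht with ht | ht <;> linarith


/-- Lemma A.7 of the paper: quadratic behaviour of `μ` at the
optimiser.  Multiplex configuration model setup: `I ≥ 2` layers, maximum degree
`Δ ≥ 2`, nonempty finite type set `D` with out/in-degrees in `{1,…,Δ}`, strictly
positive probability weights `w`; `Pset` the set of doubly stochastic edge-probability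
vectors, `π p` the stationary layer distribution and `μ p` the entropy rate
(convention `Real.log 0 = 0`).  Suppose `p ∈ Pset` is strictly positive and maximises
`μ` over `Pset`, let `q ∈ Pset`, set `ε i := |1 − q i / p i|` and assume
`max_i ε i ≤ 1/2`.  Then with `‖ε‖²_{2,π} := ∑_i π_p(i) ε i²`,
`μ_p − ‖ε‖²_{2,π} ≤ μ_q ≤ μ_p − (1/3)·‖ε‖²_{2,π}`. -/
theorem entropy_rate_quadratic_near_optimiser
    (I Δ : ℕ) (hI : 2 ≤ I) (hΔ : 2 ≤ Δ)
    (D : Type) [Fintype D] [Nonempty D]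
    (dout din : D → Fin I → ℕ)
    (hdout : ∀ α i, 1 ≤ dout α i ∧ dout α i ≤ Δ)
    (hdin : ∀ α i, 1 ≤ din α i ∧ din α i ≤ Δ)
    (w : D → ℝ) (hw : ∀ α, 0 < w α) (hw1 : ∑ α, w α = 1)
    (Pset : Set (Fin I → ℝ))
    (hPset : Pset = {p | (∀ i, 0 ≤ p i ∧ p i ≤ 1) ∧
        ∀ α : D, (∑ i, p i * (dout α i : ℝ)) = 1 ∧ (∑ i, p i * (din α i : ℝ)) = 1})
    (π : (Fin I → ℝ) → Fin I → ℝ)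
    (hπ : ∀ p i, π p i = ∑ α, w α * (dout α i : ℝ) * p i)
    (μ : (Fin I → ℝ) → ℝ)
    (hμ : ∀ p, μ p = ∑ i, π p i * Real.log (1 / p i))
    (p : Fin I → ℝ) (hp : p ∈ Pset) (hppos : ∀ i, 0 < p i)
    (hmax : ∀ q ∈ Pset, μ q ≤ μ p)
    (q : Fin I → ℝ) (hq : q ∈ Pset)
    (ε : Fin I → ℝ) (hε : ∀ i, ε i = |1 - q i / p i|)
    (hεb : ∀ i, ε i ≤ 1 / 2) :
    μ p - (∑ i, π p i * ε i ^ 2) ≤ μ q ∧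
      μ q ≤ μ p - (1 / 3) * ∑ i, π p i * ε i ^ 2 := by
  subst hPset
  obtain ⟨hpb, hpD⟩ := hp
  obtain ⟨hqb, hqD⟩ := hq
  obtain ⟨c, hc_def⟩ : ∃ c : Fin I → ℝ, ∀ i, c i = ∑ α, w α * (dout α i : ℝ) :=
    ⟨_, fun _ => rfl⟩
  have hπc : ∀ r i, π r i = c i * r i := fun r i => by
    rw [hπ, hc_def, Finset.sum_mul]
  have hc : ∀ i, 0 ≤ c i := fun i => by
    rw [hc_def]
    exact Finset.sum_nonneg fun α _ => mul_nonneg (hw α).le (Nat.cast_nonneg _)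
  obtain ⟨d, hd_def⟩ : ∃ d : Fin I → ℝ, ∀ i, d i = q i / p i - 1 := ⟨_, fun _ => rfl⟩
  have hεd : ∀ i, ε i = |d i| := fun i => by rw [hε, hd_def, abs_sub_comm]
  have hd : ∀ i, |d i| ≤ 1 / 2 := fun i => hεd i ▸ hεb i
  have hpd : ∀ i, p i * d i = q i - p i := fun i => by
    have := (hppos i).ne'
    rw [hd_def]
    field_simp
  have hqd : ∀ i, q i = p i * (1 + d i) := fun i => by linarith [hpd i]
  -- the perturbation preserves every degree constraint
  have hdout0 : ∀ α, ∑ i, p i * d i * (dout α i : ℝ) = 0 := fun α => by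
    simp only [hpd, sub_mul, Finset.sum_sub_distrib, (hpD α).1, (hqD α).1, sub_self]
  have hdin0 : ∀ α, ∑ i, p i * d i * (din α i : ℝ) = 0 := fun α => by
    simp only [hpd, sub_mul, Finset.sum_sub_distrib, (hpD α).2, (hqD α).2, sub_self]
  have hsum : ∑ i, c i * p i * d i = 0 := by
    calc ∑ i, c i * p i * d i
        = ∑ i, ∑ α, w α * (p i * d i * (dout α i : ℝ)) :=
          Finset.sum_congr rfl fun i _ => by
            rw [hc_def, mul_assoc, Finset.sum_mul]
            exact Finset.sum_congr rfl fun α _ => by ring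
      _ = 0 := by
          rw [Finset.sum_comm]
          simp only [← Finset.mul_sum, hdout0, mul_zero, Finset.sum_const_zero]
  have hline : ∀ t : ℝ, ∀ (a : Fin I → ℕ), ∑ i, p i * (a i : ℝ) = 1 →
      ∑ i, p i * d i * (a i : ℝ) = 0 →
      ∑ i, p i * (1 + t * d i) * (a i : ℝ) = 1 := fun t a h1 h0 => by
    have : ∀ i, p i * (1 + t * d i) * (a i : ℝ) =
        p i * (a i : ℝ) + t * (p i * d i * (a i : ℝ)) := fun i => by ring
    simp only [this, Finset.sum_add_distrib, ← Finset.mul_sum, h1, h0, mul_zero, add_zero]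
  have htd : ∀ t : ℝ, |t| ≤ 1 → ∀ i, |t * d i| ≤ 1 / 2 := fun t ht i => by
    rw [abs_mul]
    nlinarith [hd i, abs_nonneg (d i), abs_nonneg t]
  have hmem : ∀ t : ℝ, |t| ≤ 1 → μ (fun i => p i * (1 + t * d i)) ≤ μ p := fun t ht => by
    have hnonneg : ∀ i, 0 ≤ p i * (1 + t * d i) := fun i =>
      mul_nonneg (hppos i).le (by linarith [abs_le.mp (htd t ht i)])
    have hout := fun α => hline t (dout α) (hpD α).1 (hdout0 α)
    refine hmax _ ⟨fun i => ⟨hnonneg i, ?_⟩, fun α => ⟨hout α, ?_⟩⟩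
    · obtain ⟨α⟩ := ‹Nonempty D›
      have h1 : (1 : ℝ) ≤ dout α i := by exact_mod_cast (hdout α i).1
      calc p i * (1 + t * d i) ≤ p i * (1 + t * d i) * (dout α i : ℝ) :=
            le_mul_of_one_le_right (hnonneg i) h1
        _ ≤ ∑ j, p j * (1 + t * d j) * (dout α j : ℝ) :=
            Finset.single_le_sum
              (f := fun j => p j * (1 + t * d j) * (dout α j : ℝ))
              (fun j _ => mul_nonneg (hnonneg j) (Nat.cast_nonneg _)) (Finset.mem_univ i)
        _ = 1 := hout α
    · exact hline t (din α) (hpD α).2 (hdin0 α)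
  have hstat : ∑ i, c i * p i * d i * Real.log (p i) = 0 := by
    refine eq_zero_of_forall_abs_le_one_quadratic_nonneg
      (S := ∑ i, c i * p i * d i ^ 2)
      (Finset.sum_nonneg fun i _ =>
        mul_nonneg (mul_nonneg (hc i) (hppos i).le) (sq_nonneg _)) fun t ht => ?_
    have hle := hmem t ht
    rw [hμ, hμ] at hle
    simp only [hπc] at hle
    have hge := sum_mul_log_inv_perturb_ge c p (fun i => t * d i) hc hppos (htd t ht) (by
      simp only [mul_left_comm _ t, ← Finset.mul_sum, hsum, mul_zero])
    have h1 : ∑ i, c i * p i * (t * d i) * Real.log (p i) =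
        t * ∑ i, c i * p i * d i * Real.log (p i) := by
      rw [Finset.mul_sum]
      exact Finset.sum_congr rfl fun i _ => by ring
    have h2 : ∑ i, c i * p i * (t * d i) ^ 2 = t ^ 2 * ∑ i, c i * p i * d i ^ 2 := by
      rw [Finset.mul_sum]
      exact Finset.sum_congr rfl fun i _ => by ring
    linarith
  have hge := sum_mul_log_inv_perturb_ge c p d hc hppos hd hsum
  have hle := sum_mul_log_inv_perturb_le c p d hc hppos hd hsum
  rw [hstat, sub_zero] at hge hle
  simp only [← hqd] at hge hle
  rw [hμ, hμ]
  simp only [hπc, hεd, sq_abs]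
  exact ⟨hge, hle⟩
end

section
/- Let p ∈ 𝒫 and assume the balance condition ∑_{α∈D} w(α) α_i^+ = ∑_{α∈D} w(α) α_i^− for every layer i. Then π_p is a probability vector (∑_{j=1}^I π_p(j) = 1 and π_p(j) ≥ 0) and is stationary for the layer chain: ∑_{i=1}^I π_p(i) L_p(i,j) = π_p(j) for every j ∈ {1,…,I}. -/
/-- stationarity of the layer distribution, from the Introduction of
the paper.  Multiplex configuration model setup: `I ≥ 2` layers, maximum degree
`Δ ≥ 2`, nonempty finite type set `D` with out/in-degrees in `{1,…,Δ}`, strictly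
positive probability weights `w`.  Let `p` be doubly stochastic
(`∑_i p i · dout α i = ∑_i p i · din α i = 1` for all `α`, with `p ∈ [0,1]^I`) and
assume the balance condition `∑_α w α · dout α i = ∑_α w α · din α i` for every `i`.
Then `π_p(i) = ∑_α w α · dout α i · p i` is a probability vector and is stationary for
the layer chain `L i j = (∑_α w α · din α i · dout α j · p j)/(∑_α w α · din α i)`. -/
theorem layer_distribution_stationary
    (I Δ : ℕ) (hI : 2 ≤ I) (hΔ : 2 ≤ Δ)
    (D : Type) [Fintype D] [Nonempty D]
    (dout din : D → Fin I → ℕ)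
    (hdout : ∀ α i, 1 ≤ dout α i ∧ dout α i ≤ Δ)
    (hdin : ∀ α i, 1 ≤ din α i ∧ din α i ≤ Δ)
    (w : D → ℝ) (hw : ∀ α, 0 < w α) (hw1 : ∑ α, w α = 1)
    (p : Fin I → ℝ) (hp01 : ∀ i, 0 ≤ p i ∧ p i ≤ 1)
    (hpc : ∀ α : D, (∑ i, p i * (dout α i : ℝ)) = 1 ∧ (∑ i, p i * (din α i : ℝ)) = 1)
    (hbal : ∀ i, (∑ α, w α * (dout α i : ℝ)) = ∑ α, w α * (din α i : ℝ))
    (π : Fin I → ℝ) (hπ : ∀ i, π i = ∑ α, w α * (dout α i : ℝ) * p i)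
    (L : Fin I → Fin I → ℝ)
    (hL : ∀ i j, L i j =
      (∑ α, w α * (din α i : ℝ) * (dout α j : ℝ) * p j) / (∑ α, w α * (din α i : ℝ))) :
    (∀ j, 0 ≤ π j) ∧ (∑ j, π j = 1) ∧ ∀ j, ∑ i, π i * L i j = π j := by
  have hne : ∀ i, ∑ α, w α * (din α i : ℝ) ≠ 0 := fun i =>
    (Finset.sum_pos (fun α _ => mul_pos (hw α) (by exact_mod_cast (hdin α i).1))
      Finset.univ_nonempty).ne'
  refine ⟨fun j => ?_, ?_, fun j => ?_⟩
  · rw [hπ]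
    exact Finset.sum_nonneg fun α _ =>
      mul_nonneg (mul_nonneg (hw α).le (Nat.cast_nonneg _)) (hp01 j).1
  · simp_rw [hπ]
    rw [Finset.sum_comm, ← hw1]
    refine Finset.sum_congr rfl fun α _ => ?_
    calc ∑ i, w α * (dout α i : ℝ) * p i = w α * ∑ i, p i * (dout α i : ℝ) := by
          rw [Finset.mul_sum]
          exact Finset.sum_congr rfl fun i _ => by ring
      _ = w α := by rw [(hpc α).1, mul_one]
  · have hflow : ∀ i, π i * L i j =
        ∑ α, w α * (dout α j : ℝ) * p j * (p i * (din α i : ℝ)) := fun i => by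
      rw [hπ, hL, ← Finset.sum_mul, hbal, mul_right_comm, mul_div_cancel₀ _ (hne i),
        Finset.sum_mul]
      exact Finset.sum_congr rfl fun α _ => by ring
    simp_rw [hflow]
    rw [Finset.sum_comm, hπ]
    refine Finset.sum_congr rfl fun α _ => ?_
    rw [← Finset.mul_sum, (hpc α).2, mul_one]
end

section
/- Define F : [0,1] → ℝ by F(λ) := −2·(λ/2)·log(λ/2) − 2·((1−λ)/5)·log((1−λ)/5) − (3/2)·(2(1−λ)/5)·log(2(1−λ)/5), with the convention 0·log 0 = 0. Then F attains its maximum over [0,1] at λ_★ := 1/(1 + 5·2^{−8/5}), this maximiser is unique, and F(λ_★) = log(2 + 5·2^{−3/5}). -/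
/-- Strict tangent-line bound for `x ↦ -x log x + x log t`, which is maximised with value
`t - x` exactly at `x = t`. -/
lemma negMulLog_add_mul_log_lt_sub {x t : ℝ} (hx : 0 ≤ x) (ht : 0 < t) (hne : x ≠ t) :
    Real.negMulLog x + x * Real.log t < t - x := by
  rcases hx.eq_or_lt with rfl | hx
  · simpa using ht
  · have h := Real.log_lt_sub_one_of_pos (div_pos ht hx)
      (fun h => hne ((div_eq_one_iff_eq hx.ne').1 h).symm)
    rw [Real.log_div ht.ne' hx.ne'] at h
    have h' := mul_lt_mul_of_pos_left h hx
    have e : x * (t / x - 1) = t - x := by field_simp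
    rw [Real.negMulLog]
    linarith

/-- Strict Gibbs variational inequality on a two-point space. -/
lemma negMulLog_add_negMulLog_one_sub_lt_log_add {a b l : ℝ} (ha : 0 < a) (hb : 0 < b)
    (hl : l ∈ Set.Icc (0 : ℝ) 1) (hne : l ≠ a / (a + b)) :
    Real.negMulLog l + Real.negMulLog (1 - l) + l * Real.log a + (1 - l) * Real.log b
      < Real.log (a + b) := by
  have hs : 0 < a + b := add_pos ha hb
  have e : b / (a + b) = 1 - a / (a + b) := by field_simp; ring
  have h₁ := negMulLog_add_mul_log_lt_sub hl.1 (div_pos ha hs) hne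
  have h₂ := negMulLog_add_mul_log_lt_sub (sub_nonneg.2 hl.2) (div_pos hb hs)
    (fun h => hne (by linarith))
  rw [Real.log_div ha.ne' hs.ne'] at h₁
  rw [Real.log_div hb.ne' hs.ne'] at h₂
  linarith

/-- Equality in the Gibbs variational inequality on a two-point space. -/
lemma negMulLog_add_negMulLog_one_sub_eq_log_add {a b : ℝ} (ha : 0 < a) (hb : 0 < b) :
    Real.negMulLog (a / (a + b)) + Real.negMulLog (1 - a / (a + b))
      + a / (a + b) * Real.log a + (1 - a / (a + b)) * Real.log b = Real.log (a + b) := by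
  have hs : 0 < a + b := add_pos ha hb
  have e : 1 - a / (a + b) = b / (a + b) := by field_simp; ring
  rw [e, Real.negMulLog, Real.negMulLog, Real.log_div ha.ne' hs.ne', Real.log_div hb.ne' hs.ne']
  field_simp
  ring

lemma mul_log_div {x c : ℝ} (hc : c ≠ 0) :
    x * Real.log (x / c) = x * Real.log x - x * Real.log c := by
  rcases eq_or_ne x 0 with rfl | hx
  · simp
  · rw [Real.log_div hx hc, mul_sub]


/-- the optimiser of Example 2.5 of the paper.
With `F(λ) = −2·(λ/2)·log(λ/2) − 2·((1−λ)/5)·log((1−λ)/5)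
− (3/2)·(2(1−λ)/5)·log(2(1−λ)/5)` (the convention `0·log 0 = 0` is automatic since
`Real.log 0 = 0`), the function `F` attains its maximum over `[0,1]` at
`λ_★ = 1/(1 + 5·2^{−8/5})`, the maximiser is unique, and
`F(λ_★) = log(2 + 5·2^{−3/5})`. -/
theorem example_entropy_rate_optimiser
    (F : ℝ → ℝ)
    (hF : ∀ l : ℝ, F l =
      -(2 * (l / 2) * Real.log (l / 2))
      - 2 * ((1 - l) / 5) * Real.log ((1 - l) / 5)
      - (3 / 2) * (2 * (1 - l) / 5) * Real.log (2 * (1 - l) / 5)) :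
    (1 / (1 + 5 * (2 : ℝ) ^ (-(8 / 5) : ℝ)) ∈ Set.Icc (0 : ℝ) 1) ∧
    (∀ l ∈ Set.Icc (0 : ℝ) 1, F l ≤ F (1 / (1 + 5 * (2 : ℝ) ^ (-(8 / 5) : ℝ)))) ∧
    (∀ l ∈ Set.Icc (0 : ℝ) 1,
      F l = F (1 / (1 + 5 * (2 : ℝ) ^ (-(8 / 5) : ℝ))) →
        l = 1 / (1 + 5 * (2 : ℝ) ^ (-(8 / 5) : ℝ))) ∧
    F (1 / (1 + 5 * (2 : ℝ) ^ (-(8 / 5) : ℝ))) =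
      Real.log (2 + 5 * (2 : ℝ) ^ (-(3 / 5) : ℝ)) := by
  have hb : (0 : ℝ) < 5 * (2 : ℝ) ^ (-(3 / 5) : ℝ) := by positivity
  have hlogb : Real.log (5 * (2 : ℝ) ^ (-(3 / 5) : ℝ)) = Real.log 5 - 3 / 5 * Real.log 2 := by
    rw [Real.log_mul (by norm_num) (by positivity), Real.log_rpow two_pos]
    ring
  have hpow : (2 : ℝ) ^ (-(3 / 5) : ℝ) = 2 * (2 : ℝ) ^ (-(8 / 5) : ℝ) := by
    rw [← Real.rpow_one_add' zero_le_two (by norm_num)]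
    norm_num
  have hstar : 1 / (1 + 5 * (2 : ℝ) ^ (-(8 / 5) : ℝ)) =
      2 / (2 + 5 * (2 : ℝ) ^ (-(3 / 5) : ℝ)) := by
    rw [hpow]
    field_simp
  have hF' : ∀ l, F l = Real.negMulLog l + Real.negMulLog (1 - l) + l * Real.log 2
      + (1 - l) * Real.log (5 * (2 : ℝ) ^ (-(3 / 5) : ℝ)) := by
    intro l
    have h₁ := mul_log_div (x := l) two_ne_zero
    have h₂ := mul_log_div (x := 1 - l) (c := 5) (by norm_num)
    have h₃ := mul_log_div (x := 1 - l) (c := 5 / 2) (by norm_num)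
    rw [Real.log_div (by norm_num) two_ne_zero] at h₃
    have e : 2 * (1 - l) / 5 = (1 - l) / (5 / 2) := by ring
    rw [hF, hlogb, Real.negMulLog, Real.negMulLog, e]
    linear_combination -h₁ - 2 / 5 * h₂ - 3 / 5 * h₃
  have hmax : F (2 / (2 + 5 * (2 : ℝ) ^ (-(3 / 5) : ℝ))) =
      Real.log (2 + 5 * (2 : ℝ) ^ (-(3 / 5) : ℝ)) := by
    rw [hF', negMulLog_add_negMulLog_one_sub_eq_log_add two_pos hb]
  have hlt : ∀ l ∈ Set.Icc (0 : ℝ) 1, l ≠ 2 / (2 + 5 * (2 : ℝ) ^ (-(3 / 5) : ℝ)) →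
      F l < F (2 / (2 + 5 * (2 : ℝ) ^ (-(3 / 5) : ℝ))) := by
    intro l hl hne
    rw [hmax, hF']
    exact negMulLog_add_negMulLog_one_sub_lt_log_add two_pos hb hl hne
  rw [hstar]
  refine ⟨⟨by positivity, div_le_one_of_le₀ (by linarith) (by positivity)⟩, fun l hl => ?_,
    fun l hl h => ?_, hmax⟩
  · rcases eq_or_ne l (2 / (2 + 5 * (2 : ℝ) ^ (-(3 / 5) : ℝ))) with rfl | hne
    · exact le_rfl
    · exact (hlt l hl hne).le
  · by_contra hne
    exact (hlt l hl hne).ne h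
end

section
/- Let I ≥ 1 and t ≥ 1 be integers, let S be a finite set of sequences s : {1,…,t} → {1,…,I}, let p, r ∈ (0,1]^I, and let δ ∈ [0,1) satisfy |1 − r_i/p_i| ≤ δ for all i. For a vector u ∈ (0,1]^I and threshold φ ∈ ℝ define Q_u(φ) := ∑_{s∈S} (∏_{k=1}^t u_{s(k)}) · 1{∏_{k=1}^t u_{s(k)} > φ}. Then for every φ, (1+δ)^{−t} · Q_r((1+δ)^t · φ) ≤ Q_p(φ) ≤ (1−δ)^{−t} · Q_r((1−δ)^t · φ). -/
theorem inv_mul_indicator_le_of_le_mul {a b c φ : ℝ} (hc : 0 < c) (hb : 0 ≤ b)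
    (h : a ≤ c * b) :
    c⁻¹ * (a * (if c * φ < a then 1 else 0)) ≤ b * (if φ < b then 1 else 0) := by
  by_cases hφ : c * φ < a
  · have hφb : φ < b := lt_of_mul_lt_mul_left (hφ.trans_le h) hc.le
    simpa [hφ, hφb] using (inv_mul_le_iff₀ hc).2 h
  · simp only [hφ, if_false, mul_zero]
    positivity

theorem indicator_le_inv_mul_of_mul_le {a b c φ : ℝ} (hc : 0 < c) (hb : 0 ≤ b)
    (h : c * a ≤ b) :
    a * (if φ < a then 1 else 0) ≤ c⁻¹ * (b * (if c * φ < b then 1 else 0)) := by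
  by_cases hφ : φ < a
  · have hφb : c * φ < b := (mul_lt_mul_of_pos_left hφ hc).trans_le h
    simpa [hφ, hφb] using (le_inv_mul_iff₀ hc).2 h
  · simp only [hφ, if_false, mul_zero]
    positivity

/-- deterministic core of Proposition A.1 of the paper.
Let `S` be a finite set of layer-labelled length-`t` paths (sequences
`Fin t → Fin I`), let `p, r ∈ (0,1]^I` with relative error `|1 − r i / p i| ≤ δ < 1`,
and define the upper-tail path-weight mass
`Q u φ = ∑_{s ∈ S} (∏_k u (s k)) · 1{∏_k u (s k) > φ}`.  Then for every `φ`,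
`(1+δ)^{−t} · Q r ((1+δ)^t φ) ≤ Q p φ ≤ (1−δ)^{−t} · Q r ((1−δ)^t φ)`. -/
theorem path_weight_mass_comparison
    (I t : ℕ) (hI : 1 ≤ I) (ht : 1 ≤ t)
    (S : Finset (Fin t → Fin I))
    (p r : Fin I → ℝ)
    (hp : ∀ i, 0 < p i ∧ p i ≤ 1) (hr : ∀ i, 0 < r i ∧ r i ≤ 1)
    (δ : ℝ) (hδ0 : 0 ≤ δ) (hδ1 : δ < 1)
    (hclose : ∀ i, |1 - r i / p i| ≤ δ)
    (Q : (Fin I → ℝ) → ℝ → ℝ)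
    (hQ : ∀ u φ, Q u φ =
      ∑ s ∈ S, (∏ k, u (s k)) * (if φ < ∏ k, u (s k) then 1 else 0)) :
    ∀ φ : ℝ,
      ((1 + δ) ^ t)⁻¹ * Q r ((1 + δ) ^ t * φ) ≤ Q p φ ∧
        Q p φ ≤ ((1 - δ) ^ t)⁻¹ * Q r ((1 - δ) ^ t * φ) := by
  have hδ : 0 < 1 - δ := sub_pos.2 hδ1
  have upper (i : Fin I) : r i ≤ (1 + δ) * p i := by
    rw [← div_le_iff₀ (hp i).1]
    linarith [(abs_le.1 (hclose i)).1]
  have lower (i : Fin I) : (1 - δ) * p i ≤ r i := by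
    rw [← le_div_iff₀ (hp i).1]
    linarith [(abs_le.1 (hclose i)).2]
  intro φ
  simp only [hQ, Finset.mul_sum]
  constructor
  · refine Finset.sum_le_sum fun s _ => inv_mul_indicator_le_of_le_mul (by positivity)
      (Finset.prod_nonneg fun k _ => (hp (s k)).1.le) ?_
    simpa [Finset.prod_mul_distrib] using
      Finset.prod_le_prod (s := Finset.univ) (fun k _ => (hr (s k)).1.le) fun k _ => upper (s k)
  · refine Finset.sum_le_sum fun s _ => indicator_le_inv_mul_of_mul_le (by positivity)
      (Finset.prod_nonneg fun k _ => (hr (s k)).1.le) ?_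
    simpa [Finset.prod_mul_distrib] using
      Finset.prod_le_prod (s := Finset.univ)
        (fun k _ => mul_nonneg hδ.le (hp (s k)).1.le) fun k _ => lower (s k)
end

section
/- Let π be a probability vector on {1,…,I} and let p ∈ (0,1]^I satisfy π(k) ≥ p_k for every k. Then for all i, j ∈ {1,…,I}, Var_π(k ↦ log p_k) ≥ p_i · p_j · (log(p_i/p_j))². -/
/-- The variance of `f` under a probability vector `π` dominates the contribution
`π i * π j * (f i - f j) ^ 2` of any pair of indices. -/
theorem mul_mul_sub_sq_le_variance {ι : Type*} [Fintype ι] {π : ι → ℝ}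
    (hπ0 : ∀ k, 0 ≤ π k) (hπ1 : ∑ k, π k = 1) (f : ι → ℝ) (i j : ι) :
    π i * π j * (f i - f j) ^ 2 ≤ ∑ k, π k * f k ^ 2 - (∑ k, π k * f k) ^ 2 := by
  classical
  set m := ∑ k, π k * f k with hm
  have hvar : ∑ k, π k * (f k - m) ^ 2 = ∑ k, π k * f k ^ 2 - m ^ 2 := by
    calc
      ∑ k, π k * (f k - m) ^ 2
          = ∑ k, (π k * f k ^ 2 - 2 * m * (π k * f k) + m ^ 2 * π k) :=
        Finset.sum_congr rfl fun k _ => by ring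
      _ = ∑ k, π k * f k ^ 2 - m ^ 2 := by
        rw [Finset.sum_add_distrib, Finset.sum_sub_distrib, ← Finset.mul_sum,
          ← Finset.mul_sum, hπ1, ← hm]
        ring
  have hnonneg : ∀ k, 0 ≤ π k * (f k - m) ^ 2 := fun k => mul_nonneg (hπ0 k) (sq_nonneg _)
  rw [← hvar]
  rcases eq_or_ne i j with rfl | hij
  · simpa using Finset.sum_nonneg fun k (_ : k ∈ Finset.univ) => hnonneg k
  have pair_le (g : ι → ℝ) (hg : ∀ k, 0 ≤ g k) : g i + g j ≤ ∑ k, g k := by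
    rw [← Finset.sum_pair hij]
    exact Finset.sum_le_univ_sum_of_nonneg hg
  have hsum : π i + π j ≤ 1 := hπ1 ▸ pair_le π hπ0
  refine le_trans ?_ (pair_le _ hnonneg)
  have hscale := mul_le_mul_of_nonneg_right hsum (add_nonneg (hnonneg i) (hnonneg j))
  linarith [sq_nonneg (π i * (f i - m) + π j * (f j - m))]

/-- the key inequality in the proof of Corollary 5.2 of the paper.
Let `π` be a probability vector on `{1,…,I}` and `p ∈ (0,1]^I` with `π k ≥ p k` for
every `k`.  Then for all `i, j`,
`Var_π(k ↦ log (p k)) ≥ p i · p j · (log (p i / p j))²`, where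
`Var_π(f) = ∑_k π k · f k² − (∑_k π k · f k)²`. -/
theorem log_variance_lower_bound
    (I : ℕ) (hI : 1 ≤ I)
    (π p : Fin I → ℝ)
    (hπ0 : ∀ k, 0 ≤ π k) (hπ1 : ∑ k, π k = 1)
    (hp : ∀ k, 0 < p k ∧ p k ≤ 1)
    (hdom : ∀ k, p k ≤ π k) :
    ∀ i j : Fin I,
      p i * p j * (Real.log (p i / p j)) ^ 2 ≤
        ∑ k, π k * (Real.log (p k)) ^ 2 - (∑ k, π k * Real.log (p k)) ^ 2 := by
  intro i j
  rw [Real.log_div (hp i).1.ne' (hp j).1.ne']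
  have hmul : p i * p j ≤ π i * π j :=
    mul_le_mul (hdom i) (hdom j) (hp j).1.le (hπ0 i)
  exact (mul_le_mul_of_nonneg_right hmul (sq_nonneg _)).trans
    (mul_mul_sub_sq_le_variance hπ0 hπ1 (fun k => Real.log (p k)) i j)
end
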